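/- Let n ≥ 1050 and let G = (ℤ/2 * ℤ/2 * ℤ/2) × ℤ/n, where * denotes the free product of groups. Then there exist two G-invariant probability measures μ and ν on the configuration space {0,1}^G such that μ and ν admit a monotone coupling, but no monotone coupling of μ and ν is invariant under the diagonal left-translation action of G. -/

import Mathlib

open MeasureTheory
open scoped ENNReal

/-- Left translation of a configuration `ω : G → Λ` by a group element `g`:
`(g • ω) x = ω (g⁻¹ x)`. -/
def configTranslate {G Λ : Type*} [Group G] (g : G) (ω : G → Λ) : G → Λ :=
  fun x => ω (g⁻¹ * x)

/-- A measure on the configuration space `Λ^G` (with the product σ-algebra) is invariant if it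
is preserved by every left translation. -/
def IsInvariantConfigMeasure {G Λ : Type*} [Group G] [MeasurableSpace Λ]
    (μ : Measure (G → Λ)) : Prop :=
  ∀ g : G, μ.map (configTranslate g) = μ

/-- A coupling of `μ` and `ν` is a measure on the product whose marginals are `μ` and `ν`. -/
def IsCoupling {α β : Type*} [MeasurableSpace α] [MeasurableSpace β]
    (π : Measure (α × β)) (μ : Measure α) (ν : Measure β) : Prop :=
  π.map Prod.fst = μ ∧ π.map Prod.snd = ν

/-- A coupling of two configuration measures is monotone if almost surely the first component
is pointwise below the second. -/
def IsMonotoneCoupling {G Λ : Type*} [Preorder Λ] [MeasurableSpace Λ]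
    (π : Measure ((G → Λ) × (G → Λ))) : Prop :=
  π {p | ∀ x : G, p.1 x ≤ p.2 x} = 1

/-- A measure on pairs of configurations is invariant under the diagonal left-translation
action of `G`. -/
def IsInvariantPairMeasure {G Λ : Type*} [Group G] [MeasurableSpace Λ]
    (π : Measure ((G → Λ) × (G → Λ))) : Prop :=
  ∀ g : G, π.map (fun p => (configTranslate g p.1, configTranslate g p.2)) = π

namespace MonoCoupling

set_option linter.unusedSectionVars false

open Measure

/-- The free product of three copies of `ℤ/2`. -/
abbrev T : Type := Monoid.CoprodI fun _ : Fin 3 => Multiplicative (ZMod 2)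

/-- The nontrivial element of `ℤ/2`. -/
abbrev z : Multiplicative (ZMod 2) := Multiplicative.ofAdd 1

lemma z_ne : z ≠ 1 := by decide

/-- The three generators. -/
noncomputable def s (i : Fin 3) : T :=
  Monoid.CoprodI.of (M := fun _ : Fin 3 => Multiplicative (ZMod 2)) (i := i) z

lemma s_mul_s (i : Fin 3) : s i * s i = 1 := by
  unfold s
  rw [← map_mul]
  have : z * z = 1 := by decide
  rw [this, map_one]

lemma s_inv (i : Fin 3) : (s i)⁻¹ = s i := inv_eq_of_mul_eq_one_left (s_mul_s i)

lemma s_ne_one (i : Fin 3) : s i ≠ 1 := by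
  intro h
  have := Monoid.CoprodI.of_injective (M := fun _ : Fin 3 => Multiplicative (ZMod 2)) i
    (a₁ := z) (a₂ := 1) (by rw [map_one]; exact h)
  exact z_ne this

lemma s_inj : Function.Injective s := by
  intro i j h
  by_contra hij
  have h2 := congrArg (Monoid.CoprodI.lift
    (Pi.mulSingle (M := fun _ : Fin 3 => Multiplicative (ZMod 2) →* Multiplicative (ZMod 2))
      i (MonoidHom.id _))) h
  unfold s at h2
  rw [Monoid.CoprodI.lift_of, Monoid.CoprodI.lift_of, Pi.mulSingle_eq_same,
    Pi.mulSingle_eq_of_ne (Ne.symm hij)] at h2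
  exact z_ne h2

/-- The reduced word of the inverse. -/
noncomputable def word (v : T) : Monoid.CoprodI.Word (fun _ : Fin 3 => Multiplicative (ZMod 2)) :=
  Monoid.CoprodI.Word.equiv v⁻¹

/-- Word length. -/
noncomputable def len (v : T) : ℕ := (word v).toList.length

lemma len_lt (v : T) (i : Fin 3) (h : (word v).fstIdx ≠ some i) : len v < len (v * s i) := by
  have h1 : word (v * s i) = Monoid.CoprodI.Word.cons
      (M := fun _ : Fin 3 => Multiplicative (ZMod 2)) (i := i) z (word v) h z_ne := by
    have h3 : ∀ w : Monoid.CoprodI.Word (fun _ : Fin 3 => Multiplicative (ZMod 2)),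
      Monoid.CoprodI.Word.equiv.symm w = w.prod := fun w => rfl
    have h4 : (word v).prod = v⁻¹ := by
      rw [← h3]
      exact Equiv.symm_apply_apply _ _
    change Monoid.CoprodI.Word.equiv (v * s i)⁻¹ = _
    rw [← Equiv.eq_symm_apply, h3, Monoid.CoprodI.Word.prod_cons, h4, mul_inv_rev, s_inv]
    rfl
  unfold len
  rw [h1]
  simp

/-- The generators leading to (two of) the children of `v`. -/
noncomputable def child (v : T) (j : Fin 2) : Fin 3 := (((word v).fstIdx).getD 0).succAbove j

lemma child_inj (v : T) : Function.Injective (child v) := Fin.succAbove_right_injective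

lemma len_child (v : T) (j : Fin 2) : len v < len (v * s (child v j)) := by
  apply len_lt
  intro h
  have := Fin.succAbove_ne (((word v).fstIdx).getD 0) j
  apply this
  change child v j = _
  rw [h]
  rfl

/-- The edge from `v` to its `j`-th child. -/
noncomputable def edge (p : T × Fin 2) : Sym2 T := s(p.1, p.1 * s (child p.1 p.2))

lemma edge_inj : Function.Injective edge := by
  rintro ⟨v, j⟩ ⟨v', j'⟩ h
  have h1 := len_child v j
  have h2 := len_child v' j'
  simp only [edge, Sym2.eq_iff] at h
  rcases h with ⟨rfl, h⟩ | ⟨h3, h4⟩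
  · rw [child_inj v (s_inj (mul_left_cancel h))]
  · rw [h4] at h1
    rw [← h3] at h2
    omega

variable {A : Type} [Group A] [Fintype A] [MeasurableSpace A] [DiscreteMeasurableSpace A]

/-- The uniform measure. -/
noncomputable def U (A : Type) [Group A] [Fintype A] [MeasurableSpace A] : Measure A :=
  (PMF.uniformOfFintype A).toMeasure

instance : IsProbabilityMeasure (U A) := by unfold U; infer_instance

lemma U_singleton (a : A) : U A {a} = (Fintype.card A : ℝ≥0∞)⁻¹ := by
  unfold U
  rw [PMF.toMeasure_apply_singleton _ _ (MeasurableSet.of_discrete)]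
  simp

lemma U_map (h : A) : (U A).map (fun a => h * a) = U A := by
  apply Measure.ext_of_singleton
  intro a
  rw [Measure.map_apply Measurable.of_discrete MeasurableSet.of_discrete]
  have : (fun x => h * x) ⁻¹' {a} = {h⁻¹ * a} := by
    ext x; simp [eq_inv_mul_iff_mul_eq]
  rw [this, U_singleton, U_singleton]

/-- The law of an iid uniform family. -/
noncomputable def P (ι A : Type) [Group A] [Fintype A] [MeasurableSpace A] : Measure (ι → A) :=
  infinitePi (fun _ : ι => U A)

instance (ι : Type) : IsProbabilityMeasure (P ι A) := by unfold P; infer_instance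

lemma P_map {ι κ : Type} (f : κ → ι) (hf : Function.Injective f) (h : A) :
    (P ι A).map (fun ω k => h * ω (f k)) = P κ A := by
  have h1 : (P ι A).map (fun ω k => ω (f k)) = P κ A :=
    map_infinitePi_infinitePi_of_inj (P := fun _ : ι => U A) hf
  have h2 : (P κ A).map (fun ω k => h * ω k) = P κ A := by
    unfold P
    have := infinitePi_map_pi (fun _ : κ => U A) (f := fun _ : κ => fun a : A => h * a)
      (fun _ => Measurable.of_discrete)
    rw [this]
    simp_rw [U_map]
  have hm : Measurable (fun a : A => h * a) := Measurable.of_discrete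
  conv_rhs => rw [← h2, ← h1]
  rw [Measure.map_map (by fun_prop) (by fun_prop)]
  rfl

lemma P_single {ι : Type} (i : ι) (a : A) :
    (P ι A).real {ω | ω i = a} = (Fintype.card A : ℝ)⁻¹ := by
  classical
  have := infinitePi_pi (fun _ : ι => U A) (s := {i}) (t := fun _ => {a})
    (fun _ _ => MeasurableSet.of_discrete)
  have h2 : {ω : ι → A | ω i = a} = Set.pi (({i} : Finset ι) : Set ι) (fun _ => {a}) := by
    ext; simp
  rw [measureReal_def, h2, P, this]
  simp [U_singleton]

lemma P_pair {ι : Type} (i j : ι) (hij : i ≠ j) (a : A) :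
    (P ι A).real {ω | ω i = a ∧ ω j = a} = (Fintype.card A : ℝ)⁻¹ ^ 2 := by
  classical
  have := infinitePi_pi (fun _ : ι => U A) (s := {i, j}) (t := fun _ => {a})
    (fun _ _ => MeasurableSet.of_discrete)
  have h2 : {ω : ι → A | ω i = a ∧ ω j = a} =
      Set.pi (({i, j} : Finset ι) : Set ι) (fun _ => {a}) := by
    ext; simp
  rw [measureReal_def, h2, P, this]
  simp [U_singleton, Finset.card_pair hij]

open Classical in
/-- The small configuration. -/
noncomputable def X (ω : T × Fin 2 → A) : T × A → Bool := fun p => decide (∃ j, ω (p.1, j) = p.2)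

open Classical in
/-- The big configuration. -/
noncomputable def Y (Z : Sym2 T → A) : T × A → Bool :=
  fun p => decide (∃ i, Z s(p.1, p.1 * s i) = p.2)

lemma measurable_X : Measurable (X (A := A)) := by
  classical
  rw [measurable_pi_iff]
  intro p
  apply measurable_to_bool
  have : (fun ω : T × Fin 2 → A => X ω p) ⁻¹' {true} =
      ⋃ j, (fun ω : T × Fin 2 → A => ω (p.1, j)) ⁻¹' {p.2} := by
    ext; simp [X]
  rw [this]
  exact MeasurableSet.iUnion fun j => measurable_pi_apply _ MeasurableSet.of_discrete

lemma measurable_Y : Measurable (Y (A := A)) := by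
  classical
  rw [measurable_pi_iff]
  intro p
  apply measurable_to_bool
  have : (fun ω : Sym2 T → A => Y ω p) ⁻¹' {true} =
      ⋃ j, (fun ω : Sym2 T → A => ω s(p.1, p.1 * s j)) ⁻¹' {p.2} := by
    ext; simp [Y]
  rw [this]
  exact MeasurableSet.iUnion fun j => measurable_pi_apply _ MeasurableSet.of_discrete

lemma measurable_translate (g : T × A) :
    Measurable (configTranslate g : (T × A → Bool) → (T × A → Bool)) := by
  unfold configTranslate
  fun_prop

lemma translate_X (g : T × A) (ω : T × Fin 2 → A) :
    configTranslate g (X ω) = X (fun q => g.2 * ω (g.1⁻¹ * q.1, q.2)) := by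
  classical
  funext p
  simp [configTranslate, X, eq_inv_mul_iff_mul_eq]

lemma translate_Y (g : T × A) (ω : Sym2 T → A) :
    configTranslate g (Y ω) = Y (fun q => g.2 * ω (Sym2.map (fun v => g.1⁻¹ * v) q)) := by
  classical
  funext p
  simp only [configTranslate, Y, eq_inv_mul_iff_mul_eq, mul_assoc, Prod.fst_mul, Prod.snd_mul,
    Prod.fst_inv, Prod.snd_inv, Sym2.map_mk]
  congr

/-- Law of the small configuration. -/
noncomputable def mu (A : Type) [Group A] [Fintype A] [MeasurableSpace A] :
    Measure (T × A → Bool) := (P (T × Fin 2) A).map X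

/-- Law of the big configuration. -/
noncomputable def nu (A : Type) [Group A] [Fintype A] [MeasurableSpace A] :
    Measure (T × A → Bool) := (P (Sym2 T) A).map Y

lemma mu_prob : IsProbabilityMeasure (mu A) := isProbabilityMeasure_map measurable_X.aemeasurable

lemma nu_prob : IsProbabilityMeasure (nu A) := isProbabilityMeasure_map measurable_Y.aemeasurable

lemma mu_inv : IsInvariantConfigMeasure (mu A) := by
  intro g
  have hm : Measurable (fun a : A => g.2 * a) := Measurable.of_discrete
  have h := P_map (A := A) (fun q : T × Fin 2 => (g.1⁻¹ * q.1, q.2))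
    (by rintro ⟨a, b⟩ ⟨c, d⟩ h; simpa using h) g.2
  unfold mu
  rw [Measure.map_map (measurable_translate g) measurable_X]
  conv_rhs => rw [← h, Measure.map_map measurable_X (by fun_prop)]
  congr 1
  funext ω
  exact translate_X g ω

lemma nu_inv : IsInvariantConfigMeasure (nu A) := by
  intro g
  have hm : Measurable (fun a : A => g.2 * a) := Measurable.of_discrete
  have h := P_map (A := A) (Sym2.map (fun v : T => g.1⁻¹ * v))
    (Sym2.map.injective (mul_right_injective _)) g.2
  unfold nu
  rw [Measure.map_map (measurable_translate g) measurable_Y]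
  conv_rhs => rw [← h, Measure.map_map measurable_Y (by fun_prop)]
  congr 1
  funext ω
  exact translate_Y g ω

lemma exists_coupling : ∃ π : Measure ((T × A → Bool) × (T × A → Bool)),
    IsProbabilityMeasure π ∧ IsCoupling π (mu A) (nu A) ∧ IsMonotoneCoupling π := by
  classical
  have he : Measurable (fun (Z : Sym2 T → A) (q : T × Fin 2) => Z (edge q)) := by fun_prop
  have hf : Measurable (fun Z : Sym2 T → A => (X (fun q => Z (edge q)), Y Z)) :=
    (measurable_X.comp he).prodMk measurable_Y
  have hp : IsProbabilityMeasure
      ((P (Sym2 T) A).map (fun Z : Sym2 T → A => (X (fun q => Z (edge q)), Y Z))) :=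
    isProbabilityMeasure_map hf.aemeasurable
  refine ⟨_, hp, ⟨?_, ?_⟩, ?_⟩
  · rw [Measure.map_map measurable_fst hf]
    have h := P_map (A := A) edge edge_inj 1
    simp only [one_mul] at h
    unfold mu
    rw [← h, Measure.map_map measurable_X he]
    rfl
  · rw [Measure.map_map measurable_snd hf]
    rfl
  · apply le_antisymm prob_le_one
    refine le_trans ?_ (Measure.le_map_apply hf.aemeasurable _)
    have : (fun Z : Sym2 T → A => (X (fun q => Z (edge q)), Y Z)) ⁻¹'
        {p | ∀ x, p.1 x ≤ p.2 x} = Set.univ := by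
      ext Z
      simp only [Set.mem_preimage, Set.mem_ofPred_eq, Set.mem_univ, iff_true]
      intro x
      rw [Bool.le_iff_imp]
      simp only [X, Y, decide_eq_true_eq]
      rintro ⟨j, hj⟩
      exact ⟨child x.1 j, hj⟩
    rw [this, measure_univ]

lemma mset (x : T × A) : MeasurableSet {c : T × A → Bool | c x = true} :=
  measurableSet_eq_fun (measurable_pi_apply x) measurable_const

lemma mset2 (x y : T × A) : MeasurableSet {c : T × A → Bool | c x = true ∧ c y = true} := by
  have h := (mset x).inter (mset y)
  rwa [← Set.ofPred_and] at h

lemma mu_one : (mu A).real {c | c (1, 1) = true} =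
    2 * (Fintype.card A : ℝ)⁻¹ - (Fintype.card A : ℝ)⁻¹ ^ 2 := by
  classical
  unfold mu
  rw [map_measureReal_apply measurable_X (mset _)]
  have h : (X (A := A)) ⁻¹' {c | c (1, 1) = true} =
      {ω | ω (1, 0) = 1} ∪ {ω | ω (1, 1) = 1} := by
    ext; simp [X, Fin.exists_fin_two]
  have h1 := measureReal_union_add_inter (μ := P (T × Fin 2) A)
    (s := {ω | ω (1, 0) = 1}) (t := {ω | ω (1, 1) = 1})
    (measurable_pi_apply _ (MeasurableSet.of_discrete (s := {1})))
  have h2 := P_pair (A := A) ((1 : T), (0 : Fin 2)) (1, 1) (by simp) 1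
  rw [h]
  rw [P_single, P_single, ← Set.ofPred_and, h2] at h1
  linarith

lemma mu_two (i : Fin 3) : (mu A).real {c | c (1, 1) = true ∧ c (s i, 1) = true} ≤
    4 * (Fintype.card A : ℝ)⁻¹ ^ 2 := by
  classical
  unfold mu
  rw [map_measureReal_apply measurable_X (mset2 _ _)]
  have h : (X (A := A)) ⁻¹' {c | c (1, 1) = true ∧ c (s i, 1) = true} ⊆
      ⋃ q : Fin 2 × Fin 2, {ω | ω (1, q.1) = 1 ∧ ω (s i, q.2) = 1} := by
    intro ω
    simp only [X, Set.mem_preimage, Set.mem_ofPred_eq, decide_eq_true_eq, Set.mem_iUnion]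
    rintro ⟨⟨j, hj⟩, ⟨l, hl⟩⟩
    exact ⟨(j, l), hj, hl⟩
  refine (measureReal_mono h).trans ((measureReal_iUnion_fintype_le _).trans ?_)
  rw [Finset.sum_congr rfl (fun q _ => P_pair (A := A) ((1 : T), q.1) (s i, q.2)
    (by simp [(s_ne_one i).symm]) 1)]
  simp

lemma edges_ne (i j l : Fin 3) (h : ¬ (j = i ∧ l = i)) :
    s((1 : T), s j) ≠ s(s i, s i * s l) := by
  intro h'
  rw [Sym2.eq_iff] at h'
  rcases h' with ⟨h1, _⟩ | ⟨h1, h2⟩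
  · exact s_ne_one i h1.symm
  · apply h
    refine ⟨s_inj h2, s_inj ?_⟩
    rw [← s_inv l]
    exact (eq_inv_of_mul_eq_one_left h1.symm).symm

lemma nu_two (i : Fin 3) : (nu A).real {c | c (1, 1) = true ∧ c (s i, 1) = true} ≤
    (Fintype.card A : ℝ)⁻¹ + 9 * (Fintype.card A : ℝ)⁻¹ ^ 2 := by
  classical
  unfold nu
  rw [map_measureReal_apply measurable_Y (mset2 _ _)]
  have h : (Y (A := A)) ⁻¹' {c | c (1, 1) = true ∧ c (s i, 1) = true} ⊆
      {Z | Z s(1, s i) = 1} ∪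
      ⋃ q : Fin 3 × Fin 3, {Z | ¬ (q.1 = i ∧ q.2 = i) ∧
        (Z s(1, s q.1) = 1 ∧ Z s(s i, s i * s q.2) = 1)} := by
    intro Z
    simp only [Y, Set.mem_preimage, Set.mem_ofPred_eq, decide_eq_true_eq, Set.mem_iUnion, one_mul,
      Set.mem_union]
    rintro ⟨⟨j, hj⟩, ⟨l, hl⟩⟩
    by_cases hh : j = i ∧ l = i
    · left; rw [← hh.1]; exact hj
    · right; exact ⟨(j, l), hh, hj, hl⟩
  refine (measureReal_mono h).trans ((measureReal_union_le _ _).trans ?_)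
  rw [P_single]
  gcongr
  refine (measureReal_iUnion_fintype_le _).trans ?_
  have : ∀ q ∈ (Finset.univ : Finset (Fin 3 × Fin 3)), (P (Sym2 T) A).real
      {Z | ¬ (q.1 = i ∧ q.2 = i) ∧ (Z s(1, s q.1) = 1 ∧ Z s(s i, s i * s q.2) = 1)} ≤
      (Fintype.card A : ℝ)⁻¹ ^ 2 := by
    intro q _
    by_cases hh : q.1 = i ∧ q.2 = i
    · simp only [hh, not_true_eq_false, and_self, false_and, Set.ofPred_false, measureReal_empty]
      positivity
    · simp only [hh, not_false_eq_true, true_and]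
      exact (P_pair _ _ (edges_ne i _ _ hh) 1).le
  refine (Finset.sum_le_sum this).trans ?_
  simp

lemma nu_ae : ∀ᵐ c ∂(nu A), c (1, 1) = true → ∃ i, c (s i, 1) = true := by
  classical
  have hm : MeasurableSet {c : T × A → Bool | c (1, 1) = true → ∃ i, c (s i, 1) = true} := by
    have : {c : T × A → Bool | c (1, 1) = true → ∃ i, c (s i, 1) = true} =
        {c | c (1, 1) = true}ᶜ ∪ ⋃ i, {c | c (s i, 1) = true} := by
      ext c
      simp only [Set.mem_ofPred_eq, Set.mem_union, Set.mem_compl_iff, Set.mem_iUnion]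
      tauto
    rw [this]
    exact (mset _).compl.union (MeasurableSet.iUnion fun i => mset _)
  unfold nu
  rw [ae_map_iff measurable_Y.aemeasurable hm]
  refine Filter.Eventually.of_forall fun Z => ?_
  simp only [Y, decide_eq_true_eq, one_mul]
  rintro ⟨i, hi⟩
  refine ⟨i, i, ?_⟩
  rw [s_mul_s, Sym2.eq_swap]
  exact hi

lemma no_coupling (hA : 1050 ≤ Fintype.card A) (π : Measure ((T × A → Bool) × (T × A → Bool)))
    [IsProbabilityMeasure π] (hc : IsCoupling π (mu A) (nu A)) (hm : IsMonotoneCoupling π) :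
    ¬ IsInvariantPairMeasure π := by
  intro hinv
  -- measurability of the basic events
  have m1 : ∀ x : T × A, MeasurableSet
      {p : (T × A → Bool) × (T × A → Bool) | p.1 x = true} := fun x => measurable_fst (mset x)
  have m2 : ∀ x : T × A, MeasurableSet
      {p : (T × A → Bool) × (T × A → Bool) | p.2 x = true} := fun x => measurable_snd (mset x)
  have m12 : ∀ x y : T × A, MeasurableSet
      {p : (T × A → Bool) × (T × A → Bool) | p.1 x = true ∧ p.2 y = true} := by
    intro x y
    have h := (m1 x).inter (m2 y)
    rwa [← Set.ofPred_and] at h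
  -- monotonicity at a site
  have hle : ∀ x : T × A, ∀ᵐ p ∂π, p.1 x = true → p.2 x = true := by
    intro x
    have hms : MeasurableSet {p : (T × A → Bool) × (T × A → Bool) |
        p.1 x = true → p.2 x = true} := by
      have : {p : (T × A → Bool) × (T × A → Bool) | p.1 x = true → p.2 x = true} =
          {p | p.1 x = true}ᶜ ∪ {p | p.2 x = true} := by
        ext p
        simp only [Set.mem_ofPred_eq, Set.mem_union, Set.mem_compl_iff]
        tauto
      rw [this]
      exact (m1 x).compl.union (m2 x)
    have h1 : π {p | p.1 x = true → p.2 x = true} = 1 := by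
      apply le_antisymm prob_le_one
      rw [← hm]
      apply measure_mono
      intro p hp
      exact (Bool.le_iff_imp.1 (hp x))
    exact (prob_compl_eq_zero_iff hms).2 h1
  have hY : ∀ᵐ p ∂π, p.2 (1, 1) = true → ∃ i, p.2 (s i, 1) = true := by
    have := nu_ae (A := A)
    rw [← hc.2] at this
    exact ae_of_ae_map measurable_snd.aemeasurable this
  -- mass transport
  have hsym : ∀ i, π.real {p | p.1 (1, 1) = true ∧ p.2 (s i, 1) = true} =
      π.real {p | p.1 (s i, 1) = true ∧ p.2 (1, 1) = true} := by
    intro i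
    conv_lhs => rw [← hinv (s i, 1)]
    have ht : Measurable (fun p : (T × A → Bool) × (T × A → Bool) =>
        (configTranslate (s i, (1 : A)) p.1, configTranslate (s i, (1 : A)) p.2)) :=
      ((measurable_translate _).comp measurable_fst).prodMk
        ((measurable_translate _).comp measurable_snd)
    rw [map_measureReal_apply ht (m12 _ _)]
    congr 1
    ext p
    simp [configTranslate, s_inv, s_mul_s]
  have hX1 : π.real {p | p.1 (1, 1) = true} =
      2 * (Fintype.card A : ℝ)⁻¹ - (Fintype.card A : ℝ)⁻¹ ^ 2 := by
    rw [← mu_one, ← hc.1, map_measureReal_apply measurable_fst (mset _)]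
    rfl
  have hsum : π.real {p | p.1 (1, 1) = true} ≤
      ∑ i, π.real {p | p.1 (1, 1) = true ∧ p.2 (s i, 1) = true} := by
    refine le_trans ?_ (measureReal_iUnion_fintype_le _)
    refine ENNReal.toReal_mono (measure_ne_top _ _) (measure_mono_ae ?_)
    filter_upwards [hle (1, 1), hY] with p h1 h2 h3
    obtain ⟨i, hi⟩ := h2 (h1 h3)
    exact Set.mem_iUnion.2 ⟨i, h3, hi⟩
  have hpair : ∀ i, 2 * π.real {p | p.1 (1, 1) = true ∧ p.2 (s i, 1) = true} ≤
      (Fintype.card A : ℝ)⁻¹ + 13 * (Fintype.card A : ℝ)⁻¹ ^ 2 := by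
    intro i
    have h := measureReal_union_add_inter (μ := π)
      (s := {p | p.1 (1, 1) = true ∧ p.2 (s i, 1) = true})
      (t := {p | p.1 (s i, 1) = true ∧ p.2 (1, 1) = true})
      (m12 _ _)
    rw [← hsym i] at h
    have hu : π.real ({p | p.1 (1, 1) = true ∧ p.2 (s i, 1) = true} ∪
        {p | p.1 (s i, 1) = true ∧ p.2 (1, 1) = true}) ≤
        (Fintype.card A : ℝ)⁻¹ + 9 * (Fintype.card A : ℝ)⁻¹ ^ 2 := by
      refine le_trans ?_ (nu_two i)
      rw [← hc.2, map_measureReal_apply measurable_snd (mset2 _ _)]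
      refine ENNReal.toReal_mono (measure_ne_top _ _) (measure_mono_ae ?_)
      filter_upwards [hle (1, 1), hle (s i, 1)] with p h1 h2 h3
      rcases h3 with ⟨h3, h4⟩ | ⟨h3, h4⟩
      · exact ⟨h1 h3, h4⟩
      · exact ⟨h4, h2 h3⟩
    have hi : π.real ({p | p.1 (1, 1) = true ∧ p.2 (s i, 1) = true} ∩
        {p | p.1 (s i, 1) = true ∧ p.2 (1, 1) = true}) ≤
        4 * (Fintype.card A : ℝ)⁻¹ ^ 2 := by
      refine le_trans ?_ (mu_two i)
      rw [← hc.1, map_measureReal_apply measurable_fst (mset2 _ _)]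
      refine measureReal_mono ?_
      rintro p ⟨⟨h1, _⟩, ⟨h2, _⟩⟩
      exact ⟨h1, h2⟩
    linarith
  rw [Fin.sum_univ_three, hX1] at hsum
  have h0 := hpair 0
  have h1 := hpair 1
  have h2 := hpair 2
  have hc0 : (1050 : ℝ) ≤ Fintype.card A := by exact_mod_cast hA
  have hpos : (0 : ℝ) < (Fintype.card A : ℝ)⁻¹ := by positivity
  have hsmall : (Fintype.card A : ℝ)⁻¹ ≤ 1050⁻¹ := by gcongr
  nlinarith

end MonoCoupling

/-- **Invariant monotone coupling need not exist.** Let `n ≥ 1050` and let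
`G = (ℤ/2 * ℤ/2 * ℤ/2) × ℤ/n`, where `*` is the free product. Then there are two
`G`-invariant probability measures `μ`, `ν` on the configuration space `{0,1}^G`
(with `Bool` playing the role of `{0,1}`, ordered by `false < true`) that admit a monotone
coupling, but no monotone coupling of them is invariant under the diagonal left-translation
action of `G`. -/
theorem no_invariant_monotone_coupling (n : ℕ) (hn : 1050 ≤ n) :
    ∃ μ ν : Measure
      ((Monoid.CoprodI fun _ : Fin 3 => Multiplicative (ZMod 2)) × Multiplicative (ZMod n)
        → Bool),
      IsProbabilityMeasure μ ∧ IsProbabilityMeasure ν ∧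
      IsInvariantConfigMeasure μ ∧ IsInvariantConfigMeasure ν ∧
      (∃ π, IsProbabilityMeasure π ∧ IsCoupling π μ ν ∧ IsMonotoneCoupling π) ∧
      ∀ π, IsProbabilityMeasure π → IsCoupling π μ ν → IsMonotoneCoupling π →
        ¬ IsInvariantPairMeasure π := by
  have : NeZero n := ⟨by omega⟩
  let _ : MeasurableSpace (Multiplicative (ZMod n)) := ⊤
  have : DiscreteMeasurableSpace (Multiplicative (ZMod n)) := ⟨fun _ => trivial⟩
  have hA : 1050 ≤ Fintype.card (Multiplicative (ZMod n)) := by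
    rw [Fintype.card_multiplicative, ZMod.card]
    exact hn
  refine ⟨MonoCoupling.mu _, MonoCoupling.nu _, MonoCoupling.mu_prob, MonoCoupling.nu_prob,
    MonoCoupling.mu_inv, MonoCoupling.nu_inv, MonoCoupling.exists_coupling, ?_⟩
  intro π hp hc hm
  exact MonoCoupling.no_coupling hA π hc hm
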